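/- arXiv:2004.10953 — 7 statements merged into one kernel-verified Lean document; each statement's English description precedes it below -/
import Mathlib

section
/- Let m, n ≥ 1, let X ⊆ ℝ^m and Y ⊆ ℝ^n be sets definable with parameters in the first-order structure (ℝ, <), and let D ⊆ X × Y be definable with parameters in (ℝ, <), stable, with dimH(X) = m, dimH(Y) = n, and dimH(D) = m + n. Then there exist a finite index set I and sets X_i ⊆ X and Y_i ⊆ Y definable with parameters in (ℝ, <) for i ∈ I, with dimH(X_i) = m and dimH(Y_i) = n for each i ∈ I, such that dimH(D △ ⋃_{i∈I} X_i × Y_i) < m + n, where △ denotes symmetric difference. -/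
open Set FirstOrder MeasureTheory
open scoped ENNReal symmDiff

/-- A relation `D ⊆ S × T` is stable if there is no half-graph witness. -/
def IsStable {S T : Type*} (D : Set (S × T)) : Prop :=
  ¬ ∃ (a : ℕ → S) (b : ℕ → T), ∀ i j : ℕ, (a i, b j) ∈ D ↔ i ≤ j

noncomputable instance : Language.order.Structure ℝ := Language.orderStructure ℝ

/-- The identification of ℝ^{a+b} with ℝ^a × ℝ^b. -/
def joinR (a b : ℕ) : (Fin (a + b) → ℝ) → (Fin a → ℝ) × (Fin b → ℝ) :=
  fun v => (fun i => v (Fin.castAdd b i), fun j => v (Fin.natAdd a j))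
/-- Two tuples of reals with the same order type. -/
def SameOrder {κ : Type*} (w w' : κ → ℝ) : Prop := ∀ s t, w s < w t ↔ w' s < w' t

namespace SameOrder

variable {κ κ' : Type*} {w w' : κ → ℝ}

lemma symm (h : SameOrder w w') : SameOrder w' w := fun s t => (h s t).symm

lemma le_iff (h : SameOrder w w') (s t : κ) : w s ≤ w t ↔ w' s ≤ w' t := by
  rw [← not_lt, ← not_lt, h t s]

lemma eq_iff (h : SameOrder w w') (s t : κ) : w s = w t ↔ w' s = w' t := by
  rw [le_antisymm_iff, le_antisymm_iff, h.le_iff, h.le_iff]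

lemma comp (h : SameOrder w w') (f : κ' → κ) : SameOrder (w ∘ f) (w' ∘ f) :=
  fun s t => h (f s) (f t)

lemma exists_extension [Finite κ] (h : SameOrder w w') (x : ℝ) :
    ∃ x', ∀ s, (w s < x ↔ w' s < x') ∧ (x < w s ↔ x' < w' s) := by
  classical
  have := Fintype.ofFinite κ
  by_cases hx : ∃ s, w s = x
  · obtain ⟨s, rfl⟩ := hx
    exact ⟨w' s, fun t => ⟨h t s, h s t⟩⟩
  · push Not at hx
    obtain ⟨x', h₁, h₂⟩ := Order.exists_between_finsets
      ((Finset.univ.filter fun s => w s < x).image w')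
      ((Finset.univ.filter fun s => x < w s).image w') (by
        simp only [Finset.mem_image, Finset.mem_filter, Finset.mem_univ, true_and]
        rintro _ ⟨s, hs, rfl⟩ _ ⟨t, ht, rfl⟩
        exact (h s t).1 (hs.trans ht))
    simp only [Finset.mem_image, Finset.mem_filter, Finset.mem_univ, true_and,
      forall_exists_index, and_imp, forall_apply_eq_imp_iff₂] at h₁ h₂
    refine ⟨x', fun s => ?_⟩
    rcases lt_or_gt_of_ne (hx s) with hs | hs
    · exact ⟨iff_of_true hs (h₁ s hs), iff_of_false hs.not_gt (h₁ s hs).not_gt⟩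
    · exact ⟨iff_of_false hs.not_gt (h₂ s hs).not_gt, iff_of_true hs (h₂ s hs)⟩

end SameOrder

lemma exists_finset_term_realize {α : Type*} {k : ℕ} (t : Language.order.Term (α ⊕ Fin k)) :
    ∃ F : Finset α, ∀ F', F ⊆ F' → ∃ s : F' ⊕ Fin k, ∀ (v : α → ℝ) (xs : Fin k → ℝ),
      t.realize (Sum.elim v xs) = Sum.elim (fun a : F' => v a) xs s := by
  classical
  rcases t with ⟨a | i⟩ | ⟨f, ts⟩
  · exact ⟨{a}, fun F' h => ⟨.inl ⟨a, h (Finset.mem_singleton_self a)⟩, fun v xs => rfl⟩⟩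
  · exact ⟨∅, fun F' h => ⟨.inr i, fun v xs => rfl⟩⟩
  · exact isEmptyElim f

/-- A formula in the language of orders only depends on the order type of its variables. -/
lemma exists_finset_realize_iff {α : Type*} {k : ℕ} (φ : Language.order.BoundedFormula α k) :
    ∃ F : Finset α, ∀ F', F ⊆ F' → ∀ (v v' : α → ℝ) (xs xs' : Fin k → ℝ),
      SameOrder (Sum.elim (fun a : F' => v a) xs) (Sum.elim (fun a : F' => v' a) xs') →
      (φ.Realize v xs ↔ φ.Realize v' xs') := by
  classical
  induction φ with
  | falsum => exact ⟨∅, fun F' _ v v' xs xs' _ => Iff.rfl⟩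
  | equal t₁ t₂ =>
    obtain ⟨F₁, h₁⟩ := exists_finset_term_realize t₁
    obtain ⟨F₂, h₂⟩ := exists_finset_term_realize t₂
    refine ⟨F₁ ∪ F₂, fun F' hF v v' xs xs' h => ?_⟩
    obtain ⟨s₁, hs₁⟩ := h₁ F' (Finset.union_subset_left hF)
    obtain ⟨s₂, hs₂⟩ := h₂ F' (Finset.union_subset_right hF)
    simp only [Language.BoundedFormula.Realize, hs₁, hs₂]
    exact h.eq_iff _ _
  | @rel _ l R ts =>
    obtain rfl : l = 2 := by cases R; rfl
    obtain rfl : R = .le := Subsingleton.elim _ _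
    obtain ⟨F₁, h₁⟩ := exists_finset_term_realize (ts 0)
    obtain ⟨F₂, h₂⟩ := exists_finset_term_realize (ts 1)
    refine ⟨F₁ ∪ F₂, fun F' hF v v' xs xs' h => ?_⟩
    obtain ⟨s₁, hs₁⟩ := h₁ F' (Finset.union_subset_left hF)
    obtain ⟨s₂, hs₂⟩ := h₂ F' (Finset.union_subset_right hF)
    change (ts 0).realize _ ≤ (ts 1).realize _ ↔ (ts 0).realize _ ≤ (ts 1).realize _
    simp only [hs₁, hs₂]
    exact h.le_iff _ _
  | imp f₁ f₂ ih₁ ih₂ =>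
    obtain ⟨F₁, h₁⟩ := ih₁
    obtain ⟨F₂, h₂⟩ := ih₂
    refine ⟨F₁ ∪ F₂, fun F' hF v v' xs xs' h => ?_⟩
    exact imp_congr (h₁ F' (Finset.union_subset_left hF) v v' xs xs' h)
      (h₂ F' (Finset.union_subset_right hF) v v' xs xs' h)
  | all f ih =>
    obtain ⟨F, hF⟩ := ih
    refine ⟨F, fun F' hF' => ?_⟩
    have key : ∀ (v v' : α → ℝ) (xs xs' : Fin _ → ℝ),
        SameOrder (Sum.elim (fun a : F' => v a) xs) (Sum.elim (fun a : F' => v' a) xs') →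
        f.all.Realize v xs → f.all.Realize v' xs' := by
      intro v v' xs xs' h hf x'
      obtain ⟨x, hx⟩ := h.symm.exists_extension x'
      refine (hF F' hF' v v' (Fin.snoc xs x) (Fin.snoc xs' x') ?_).1 (hf x)
      have hl := fun s => hx (.inl s)
      have hr := fun s => hx (.inr s)
      simp only [Sum.elim_inl, Sum.elim_inr] at hl hr
      rintro (s | s) (t | t)
      · exact h (.inl s) (.inl t)
      · cases t using Fin.lastCases with
        | last => simpa using (hl s).1.symm
        | cast t => simpa using h (.inl s) (.inr t)
      · cases s using Fin.lastCases with
        | last => simpa using (hl t).2.symm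
        | cast s => simpa using h (.inr s) (.inl t)
      · cases s using Fin.lastCases with
        | last =>
          cases t using Fin.lastCases with
          | last => simp
          | cast t => simpa using (hr t).2.symm
        | cast s =>
          cases t using Fin.lastCases with
          | last => simpa using (hr s).1.symm
          | cast t => simpa using h (.inr s) (.inr t)
    exact fun v v' xs xs' h => ⟨key v v' xs xs' h, key v' v xs' xs h.symm⟩

/-- A tuple extended by a finite set of parameters. -/
def withParams (C : Finset ℝ) {ι : Type*} (v : ι → ℝ) : ι ⊕ C → ℝ := Sum.elim v (↑)

/-- A definable set of tuples is a union of order types over finitely many parameters. -/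
lemma Set.Definable.exists_params {ι : Type*} {S : Set (ι → ℝ)}
    (hS : Set.Definable (Set.univ : Set ℝ) Language.order S) :
    ∃ C : Finset ℝ, ∀ C', C ⊆ C' → ∀ v v' : ι → ℝ,
      SameOrder (withParams C' v) (withParams C' v') → (v ∈ S ↔ v' ∈ S) := by
  classical
  obtain ⟨φ, rfl⟩ := Set.definable_iff_exists_formula_sum.1 hS
  obtain ⟨F, hF⟩ := exists_finset_realize_iff φ
  refine ⟨F.toLeft.image (↑), fun C' hC v v' h => ?_⟩
  simp only [Set.mem_ofPred_eq, Language.Formula.Realize]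
  refine hF F subset_rfl (Sum.elim (↑) v) (Sum.elim (↑) v') _ _ ?_
  have key : ∀ s : F ⊕ Fin 0, ∃ t : ι ⊕ C', ∀ (v : ι → ℝ) (xs : Fin 0 → ℝ),
      Sum.elim (fun a : F => (Sum.elim (↑) v : (Set.univ : Set ℝ) ⊕ ι → ℝ) a) xs s =
        withParams C' v t := by
    rintro (⟨c | i, hs⟩ | s)
    · exact ⟨.inr ⟨c, hC (Finset.mem_image_of_mem _ (by simpa using hs))⟩, fun v xs => rfl⟩
    · exact ⟨.inl i, fun v xs => rfl⟩
    · exact s.elim0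
  choose g hg using key
  intro s t
  rw [hg, hg, hg, hg]
  exact h _ _

/-- A pair of tuples as a single tuple extended by parameters. -/
def jointTuple (C : Finset ℝ) {ι κ : Type*} (p : (ι → ℝ) × (κ → ℝ)) : (ι ⊕ κ) ⊕ C → ℝ :=
  withParams C (Sum.elim p.1 p.2)

section

variable {ι κ : Type*} {C : Finset ℝ}

lemma continuous_withParams (s : ι ⊕ C) : Continuous fun v : ι → ℝ => withParams C v s := by
  rcases s with i | c
  · exact continuous_apply i
  · exact continuous_const

lemma continuous_jointTuple (s : (ι ⊕ κ) ⊕ C) :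
    Continuous fun p : (ι → ℝ) × (κ → ℝ) => jointTuple C p s := by
  rcases s with (i | j) | c
  · exact (continuous_apply i).comp continuous_fst
  · exact (continuous_apply j).comp continuous_snd
  · exact continuous_const

lemma dimH_coincidence_le [Fintype ι] [Fintype κ] (i : ι ⊕ κ) (t : (ι ⊕ κ) ⊕ C)
    (ht : .inl i ≠ t) :
    dimH {p : (ι → ℝ) × (κ → ℝ) | jointTuple C p (.inl i) = jointTuple C p t} ≤
      ((Fintype.card ι + Fintype.card κ - 1 : ℕ) : ℝ≥0∞) := by
  classical
  obtain ⟨τ, hτ, hτp⟩ : ∃ τ : ({k // k ≠ i} → ℝ) → ℝ, ContDiff ℝ 1 τ ∧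
      ∀ p : (ι → ℝ) × (κ → ℝ), τ (fun k => Sum.elim p.1 p.2 k.1) = jointTuple C p t := by
    rcases t with k | c
    · exact ⟨fun u => u ⟨k, fun h => ht (h ▸ rfl)⟩, contDiff_apply ℝ ℝ _, fun p => rfl⟩
    · exact ⟨fun _ => c, contDiff_const, fun p => rfl⟩
  let e : ({k // k ≠ i} → ℝ) → ι ⊕ κ → ℝ := fun u k => if h : k = i then τ u else u ⟨k, h⟩
  have he : ∀ k, ContDiff ℝ 1 fun u => e u k := by
    intro k
    by_cases h : k = i
    · simpa [e, h] using hτ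
    · simpa [e, h] using contDiff_apply ℝ ℝ _
  let g : ({k // k ≠ i} → ℝ) → (ι → ℝ) × (κ → ℝ) :=
    fun u => (fun a => e u (.inl a), fun b => e u (.inr b))
  have hg : ContDiff ℝ 1 g :=
    (contDiff_pi.2 fun a => he (.inl a)).prodMk (contDiff_pi.2 fun b => he (.inr b))
  calc _ ≤ dimH (Set.range g) := by
        refine dimH_mono fun p hp => ⟨fun k => Sum.elim p.1 p.2 k.1, ?_⟩
        have hek : ∀ k, e (fun k => Sum.elim p.1 p.2 k.1) k = Sum.elim p.1 p.2 k := by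
          intro k
          by_cases h : k = i
          · subst h
            simp only [e, dif_pos, hτp]
            exact hp.symm
          · simp only [e, dif_neg h]
        exact Prod.ext (funext fun a => hek (.inl a)) (funext fun b => hek (.inr b))
    _ ≤ _ := hg.dimH_range_le
    _ = _ := by
      congr 1
      rw [Module.finrank_fintype_fun_eq_card, Fintype.card_subtype_compl]
      simp

/-- Pairs of tuples with a coincidence between coordinates or parameters form a small set. -/
lemma dimH_not_injective_lt [Fintype ι] [Fintype κ] [Nonempty ι] (C : Finset ℝ) :
    dimH {p : (ι → ℝ) × (κ → ℝ) | ¬ Function.Injective (jointTuple C p)} <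
      ((Fintype.card ι + Fintype.card κ : ℕ) : ℝ≥0∞) := by
  have hsub : {p : (ι → ℝ) × (κ → ℝ) | ¬ Function.Injective (jointTuple C p)} ⊆
      ⋃ x : {x : (ι ⊕ κ) × ((ι ⊕ κ) ⊕ C) // .inl x.1 ≠ x.2},
        {p | jointTuple C p (.inl x.1.1) = jointTuple C p x.1.2} := by
    intro p hp
    simp only [Set.mem_ofPred_eq, Function.Injective, not_forall] at hp
    obtain ⟨s, t, hst, hne⟩ := hp
    rw [Set.mem_iUnion]
    rcases s with i | c
    · exact ⟨⟨(i, t), hne⟩, hst⟩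
    rcases t with i | d
    · exact ⟨⟨(i, .inr c), Ne.symm hne⟩, hst.symm⟩
    · exact absurd (congrArg Sum.inr (Subtype.ext hst)) hne
  refine (dimH_mono hsub).trans_lt ?_
  rw [dimH_iUnion]
  refine (iSup_le fun x => dimH_coincidence_le _ _ x.2).trans_lt ?_
  have := Fintype.card_pos (α := ι)
  exact_mod_cast (by omega)

end

section

variable {ι κ : Type*} {C : Finset ℝ} {p q r : (ι → ℝ) × (κ → ℝ)} {ε z : ℝ}

/-- `q` is within `ε` of `p`, where distinct values of `p` are at least `2 * ε` apart. -/
structure SepNear (C : Finset ℝ) (ε : ℝ) (p q : (ι → ℝ) × (κ → ℝ)) : Prop where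
  sep : ∀ s t, jointTuple C p s < jointTuple C p t → jointTuple C p s + 2 * ε ≤ jointTuple C p t
  near : ∀ s, |jointTuple C q s - jointTuple C p s| < ε

lemma SepNear.lt (hq : SepNear C ε p q) {s t : (ι ⊕ κ) ⊕ C}
    (h : jointTuple C p s < jointTuple C p t) : jointTuple C q s < jointTuple C q t := by
  have h₁ := hq.sep s t h
  have h₂ := abs_lt.1 (hq.near s)
  have h₃ := abs_lt.1 (hq.near t)
  linarith

lemma sameOrder_of_near (ha : Function.Injective (withParams C p.1))
    (hb : Function.Injective (withParams C p.2)) (hq : SepNear C ε p q) (hr : SepNear C ε p r)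
    (hagree : ∀ s, jointTuple C p s ≠ z → jointTuple C q s = jointTuple C r s)
    (hlt : ∀ i j, p.1 i = z → p.2 j = z → (q.1 i < q.2 j ↔ r.1 i < r.2 j))
    (hgt : ∀ i j, p.1 i = z → p.2 j = z → (q.2 j < q.1 i ↔ r.2 j < r.1 i)) :
    SameOrder (jointTuple C q) (jointTuple C r) := by
  intro s t
  rcases lt_trichotomy (jointTuple C p s) (jointTuple C p t) with h | h | h
  · exact iff_of_true (hq.lt h) (hr.lt h)
  · by_cases hz : jointTuple C p s = z
    · have hz' := h.symm.trans hz
      rcases s with (i | j) | c <;> rcases t with (i' | j') | c'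
      · obtain rfl : i = i' := Sum.inl_injective (ha h)
        simp
      · exact hlt i j' hz hz'
      · exact absurd (@ha (.inl i) (.inr c') h) Sum.inl_ne_inr
      · exact hgt i' j hz' hz
      · obtain rfl : j = j' := Sum.inl_injective (hb h)
        simp
      · exact absurd (@hb (.inl j) (.inr c') h) Sum.inl_ne_inr
      · exact absurd (@ha (.inr c) (.inl i') h) Sum.inr_ne_inl
      · exact absurd (@hb (.inr c) (.inl j') h) Sum.inr_ne_inl
      · exact Iff.rfl
    · rw [hagree s hz, hagree t (h ▸ hz)]
  · exact iff_of_false (hq.lt h).not_gt (hr.lt h).not_gt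

lemma exists_interlacing (hε : 0 < ε) (z : ℝ) (Q : Prop) :
    ∃ u : ℕ → ℝ, (∀ k, |u k - z| < ε) ∧ Function.Injective u ∧
      ∀ k l, u (2 * k) < u (2 * l + 1) ↔ (k ≤ l ↔ Q) := by
  have hanti : StrictAnti fun k : ℕ => ε / (k + 2) := by
    intro k l h
    have : (k : ℝ) < l := by exact_mod_cast h
    exact div_lt_div_of_pos_left hε (by positivity) (by linarith)
  have hbound : ∀ k : ℕ, |ε / ((k : ℝ) + 2)| < ε := by
    intro k
    rw [abs_of_pos (by positivity)]
    exact div_lt_self hε (by linarith [Nat.cast_nonneg (α := ℝ) k])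
  by_cases hQ : Q
  · have hu : StrictMono fun k : ℕ => z - ε / (k + 2) := fun k l h =>
      sub_lt_sub_left (hanti h) z
    refine ⟨_, fun k => ?_, hu.injective, fun k l => ?_⟩
    · simpa using hbound k
    · rw [hu.lt_iff_lt]
      simp only [hQ, iff_true]
      omega
  · have hu : StrictAnti fun k : ℕ => z + ε / (k + 2) := fun k l h =>
      add_lt_add_right (hanti h) z
    refine ⟨_, fun k => ?_, hu.injective, fun k l => ?_⟩
    · simpa using hbound k
    · rw [hu.lt_iff_gt]
      simp only [hQ, iff_false]
      omega

variable {D : Set ((ι → ℝ) × (κ → ℝ))}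

/-- Stability forbids that moving a single coincidence changes membership. -/
lemma IsStable.mem_of_near (hD : IsStable D)
    (hinv : ∀ p q, SameOrder (jointTuple C p) (jointTuple C q) → (p ∈ D ↔ q ∈ D)) (hε : 0 < ε)
    (ha : Function.Injective (withParams C p.1))
    (hb : Function.Injective (withParams C p.2)) (hq : SepNear C ε p q) (hr : SepNear C ε p r)
    (hagree : ∀ s, jointTuple C p s ≠ z → jointTuple C q s = jointTuple C r s)
    (hqne : ∀ i j, p.1 i = z → p.2 j = z → q.1 i ≠ q.2 j)
    (hrne : ∀ i j, p.1 i = z → p.2 j = z → r.1 i ≠ r.2 j) (hqD : q ∈ D) : r ∈ D := by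
  classical
  have key : ∀ {x y : (ι → ℝ) × (κ → ℝ)}, SepNear C ε p x → SepNear C ε p y →
      (∀ s, jointTuple C p s ≠ z → jointTuple C x s = jointTuple C y s) →
      (∀ i j, p.1 i = z → p.2 j = z → x.1 i ≠ x.2 j) →
      (∀ i j, p.1 i = z → p.2 j = z → y.1 i ≠ y.2 j) →
      (∀ i j, p.1 i = z → p.2 j = z → (x.1 i < x.2 j ↔ y.1 i < y.2 j)) → (x ∈ D ↔ y ∈ D) := by
    intro x y hx hy hxy hxne hyne hlt
    refine hinv x y (sameOrder_of_near ha hb hx hy hxy hlt fun i j hi hj => ?_)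
    rw [← not_iff_not, not_lt, not_lt, (hxne i j hi hj).le_iff_lt, (hyne i j hi hj).le_iff_lt]
    exact hlt i j hi hj
  by_contra hrD
  obtain ⟨i, j, hi, hj, hij⟩ : ∃ i j, p.1 i = z ∧ p.2 j = z ∧
      ¬ (q.1 i < q.2 j ↔ r.1 i < r.2 j) := by
    by_contra! h
    exact hrD ((key hq hr hagree hqne hrne fun i j hi hj => h i j hi hj).1 hqD)
  have hi' : ∀ i', p.1 i' = z → i' = i := fun i' h =>
    Sum.inl_injective (@ha (.inl i') (.inl i) (h.trans hi.symm))
  have hj' : ∀ j', p.2 j' = z → j' = j := fun j' h =>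
    Sum.inl_injective (@hb (.inl j') (.inl j) (h.trans hj.symm))
  obtain ⟨u, hu, huinj, hult⟩ := exists_interlacing hε z (q.1 i < q.2 j)
  refine hD ⟨fun k => Function.update q.1 i (u (2 * k)),
    fun l => Function.update q.2 j (u (2 * l + 1)), fun k l => ?_⟩
  set x : (ι → ℝ) × (κ → ℝ) :=
    (Function.update q.1 i (u (2 * k)), Function.update q.2 j (u (2 * l + 1))) with hx
  have hxi : x.1 i = u (2 * k) := by simp [hx]
  have hxj : x.2 j = u (2 * l + 1) := by simp [hx]
  have hxq : ∀ s, jointTuple C p s ≠ z → jointTuple C x s = jointTuple C q s := by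
    rintro ((i' | j') | c) hs
    · exact Function.update_of_ne (fun h => hs ((congrArg p.1 h).trans hi)) _ _
    · exact Function.update_of_ne (fun h => hs ((congrArg p.2 h).trans hj)) _ _
    · rfl
  have hxnear : SepNear C ε p x := by
    refine ⟨hq.sep, ?_⟩
    rintro ((i' | j') | c)
    · by_cases h : i' = i
      · subst h
        change |x.1 i' - p.1 i'| < ε
        rw [hxi, hi]
        exact hu _
      · rw [hxq (.inl (.inl i')) fun hz => h (hi' i' hz)]
        exact hq.near _
    · by_cases h : j' = j
      · subst h
        change |x.2 j' - p.2 j'| < ε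
        rw [hxj, hj]
        exact hu _
      · rw [hxq (.inl (.inr j')) fun hz => h (hj' j' hz)]
        exact hq.near _
    · exact hq.near (.inr c)
  have hxne : ∀ i j, p.1 i = z → p.2 j = z → x.1 i ≠ x.2 j := by
    intro i' j' h₁ h₂
    rw [hi' i' h₁, hj' j' h₂, hxi, hxj]
    exact fun h => by have := huinj h; omega
  by_cases hkl : k ≤ l
  · refine iff_of_true ((key hxnear hq hxq hxne hqne fun i' j' h₁ h₂ => ?_).2 hqD) hkl
    rw [hi' i' h₁, hj' j' h₂, hxi, hxj, hult]
    tauto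
  · refine iff_of_false (fun h => hrD ((key hxnear hr
      (fun s hs => (hxq s hs).trans (hagree s hs)) hxne hrne fun i' j' h₁ h₂ => ?_).1 h)) hkl
    rw [hi' i' h₁, hj' j' h₂, hxi, hxj, hult]
    tauto

lemma IsStable.mem_of_near_of_injective [Finite ι] [Finite κ] (hD : IsStable D)
    (hinv : ∀ p q, SameOrder (jointTuple C p) (jointTuple C q) → (p ∈ D ↔ q ∈ D)) (hε : 0 < ε)
    (ha : Function.Injective (withParams C p.1))
    (hb : Function.Injective (withParams C p.2)) (hq : SepNear C ε p q) (hr : SepNear C ε p r)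
    (hqi : Function.Injective (jointTuple C q)) (hri : Function.Injective (jointTuple C r))
    (hqD : q ∈ D) : r ∈ D := by
  classical
  have := Fintype.ofFinite ι
  have := Fintype.ofFinite κ
  have hne : ∀ {x : (ι → ℝ) × (κ → ℝ)}, Function.Injective (jointTuple C x) →
      ∀ i j, x.1 i ≠ x.2 j := fun hx i j h =>
    Sum.inl_ne_inr (Sum.inl_injective (@hx (.inl (.inl i)) (.inl (.inr j)) h))
  let H : Finset ℝ → (ι → ℝ) × (κ → ℝ) := fun Z =>
    (fun i => if p.1 i ∈ Z then r.1 i else q.1 i, fun j => if p.2 j ∈ Z then r.2 j else q.2 j)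
  have hH : ∀ Z s, jointTuple C (H Z) s =
      if jointTuple C p s ∈ Z then jointTuple C r s else jointTuple C q s := by
    rintro Z ((i | j) | c)
    · rfl
    · rfl
    · exact (ite_self _).symm
  have hnear : ∀ Z, SepNear C ε p (H Z) := fun Z => ⟨hq.sep, fun s => by
    rw [hH]
    split_ifs
    exacts [hr.near s, hq.near s]⟩
  have hmem : ∀ Z, H Z ∈ D := by
    intro Z
    induction Z using Finset.induction_on with
    | empty => simpa [H] using hqD
    | insert z Z hz ih =>
      refine hD.mem_of_near (z := z) hinv hε ha hb (hnear Z) (hnear (insert z Z)) (fun s hs => ?_)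
        (fun i j hi hj => ?_) (fun i j hi hj => ?_) ih
      · simp [hH, hs]
      · simpa [H, hi, hj, hz] using hne hqi i j
      · simpa [H, hi, hj] using hne hri i j
  have hr' : H (Finset.univ.image p.1 ∪ Finset.univ.image p.2) = r := by
    simp [H]
  exact hr' ▸ hmem _

lemma eventually_sepNear [Finite ι] [Finite κ] (C : Finset ℝ) (p : (ι → ℝ) × (κ → ℝ)) :
    ∃ ε > 0, ∀ᶠ q in nhds p, SepNear C ε p q := by
  have h₁ : ∀ᶠ ε in nhdsWithin (0 : ℝ) (Set.Ioi 0), ∀ s t,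
      jointTuple C p s < jointTuple C p t →
        jointTuple C p s + 2 * ε ≤ jointTuple C p t := by
    simp only [Filter.eventually_all]
    intro s t h
    have : Filter.Tendsto (fun ε : ℝ => jointTuple C p s + 2 * ε) (nhds 0)
        (nhds (jointTuple C p s + 2 * 0)) := (by fun_prop : Continuous _).tendsto 0
    exact ((this.eventually_lt_const (by simpa using h)).filter_mono nhdsWithin_le_nhds).mono
      fun _ => le_of_lt
  obtain ⟨ε, hsep, hε⟩ := (h₁.and self_mem_nhdsWithin).exists
  refine ⟨ε, hε, ?_⟩
  have h₂ : ∀ᶠ q in nhds p, ∀ s, |jointTuple C q s - jointTuple C p s| < ε := by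
    rw [Filter.eventually_all]
    intro s
    exact Metric.tendsto_nhds.1 (continuous_jointTuple (C := C) s).continuousAt ε hε
  exact h₂.mono fun q hq => ⟨hsep, hq⟩

end

/-- The tuples satisfying all strict inequalities, among coordinates and parameters, that `a`
satisfies. -/
def orderCell (C : Finset ℝ) {ι : Type*} (a : ι → ℝ) : Set (ι → ℝ) :=
  {v | ∀ s t, withParams C a s < withParams C a t → withParams C v s < withParams C v t}

section

variable {ι κ : Type*} {C : Finset ℝ} {a v : ι → ℝ}

lemma self_mem_orderCell : a ∈ orderCell C a := fun _ _ h => h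

lemma injective_of_mem_orderCell (ha : Function.Injective (withParams C a))
    (hv : v ∈ orderCell C a) : Function.Injective (withParams C v) := by
  intro s t hst
  by_contra hne
  rcases lt_or_gt_of_ne (ha.ne hne) with h | h
  · exact (hv s t h).ne hst
  · exact (hv t s h).ne hst.symm

lemma sameOrder_of_mem_orderCell (ha : Function.Injective (withParams C a))
    (hv : v ∈ orderCell C a) : SameOrder (withParams C a) (withParams C v) := by
  intro s t
  refine ⟨hv s t, fun h => ?_⟩
  by_contra hle
  rcases (not_lt.1 hle).lt_or_eq with h' | h'
  · exact h.not_gt (hv t s h')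
  · exact h.ne (by rw [ha h'])

lemma isOpen_orderCell [Finite ι] : IsOpen (orderCell C a) := by
  simp only [orderCell, Set.ofPred_forall]
  exact isOpen_iInter_of_finite fun s => isOpen_iInter_of_finite fun t =>
    isOpen_iInter_of_finite fun _ =>
      isOpen_lt (continuous_withParams s) (continuous_withParams t)

lemma withParams_convexComb {α β : ℝ} (h : α + β = 1) (v w : ι → ℝ) (s : ι ⊕ C) :
    withParams C (α • v + β • w) s = α * withParams C v s + β * withParams C w s := by
  rcases s with i | c
  · rfl
  · simp [withParams, ← add_mul, h]

lemma convex_orderCell : Convex ℝ (orderCell C a) := by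
  intro v hv w hw α β hα hβ hαβ s t h
  rw [withParams_convexComb hαβ, withParams_convexComb hαβ]
  have h₁ := hv s t h
  have h₂ := hw s t h
  rcases hα.eq_or_lt with rfl | hα
  · obtain rfl : β = 1 := by simpa using hαβ
    simpa using h₂
  · have h₃ := mul_lt_mul_of_pos_left h₁ hα
    have h₄ := mul_le_mul_of_nonneg_left h₂.le hβ
    linarith

lemma finite_range_orderCell [Finite ι] (C : Finset ℝ) :
    (Set.range fun a : ι → ℝ => orderCell C a).Finite := by
  let F : (ι ⊕ C → ι ⊕ C → Prop) → Set (ι → ℝ) := fun R =>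
    {v | ∀ s t, R s t → withParams C v s < withParams C v t}
  refine (Set.finite_range F).subset ?_
  rintro _ ⟨a, rfl⟩
  exact ⟨fun s t => withParams C a s < withParams C a t, rfl⟩

lemma definable_withParams_lt (s t : ι ⊕ C) :
    Set.Definable (Set.univ : Set ℝ) Language.order
      {v : ι → ℝ | withParams C v s < withParams C v t} := by
  let σ : ι ⊕ C → (Set.univ : Set ℝ) ⊕ ι :=
    Sum.elim .inr fun c => .inl ⟨c, Set.mem_univ _⟩
  have hσ : ∀ (v : ι → ℝ) s, (Sum.elim (↑) v : (Set.univ : Set ℝ) ⊕ ι → ℝ) (σ s) =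
      withParams C v s := by
    rintro v (i | c) <;> rfl
  have h : Set.Definable (Set.univ : Set ℝ) Language.order
      {v : ι → ℝ | withParams C v t ≤ withParams C v s} := by
    refine Set.definable_iff_exists_formula_sum.2
      ⟨(Language.leSymb : Language.order.Relations 2).formula₂ (.var (σ t)) (.var (σ s)), ?_⟩
    ext v
    simp only [Set.mem_ofPred_eq, ← hσ, Language.Formula.realize_rel₂]
    rfl
  convert h.compl using 1
  ext v
  simp

lemma definable_orderCell [Finite ι] :
    Set.Definable (Set.univ : Set ℝ) Language.order (orderCell C a) := by
  simp only [orderCell, Set.ofPred_forall]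
  refine Set.definable_iInter_of_finite fun s => Set.definable_iInter_of_finite fun t => ?_
  by_cases h : withParams C a s < withParams C a t
  · simpa [h] using definable_withParams_lt s t
  · simp [h]

lemma dimH_orderCell [Fintype ι] : dimH (orderCell C a) = Fintype.card ι := by
  rw [Real.dimH_of_mem_nhds (isOpen_orderCell.mem_nhds self_mem_orderCell),
    Module.finrank_fintype_fun_eq_card]

variable {D : Set ((ι → ℝ) × (κ → ℝ))} {p q : (ι → ℝ) × (κ → ℝ)}

lemma injective_withParams_fst (hp : Function.Injective (jointTuple C p)) :
    Function.Injective (withParams C p.1) := by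
  have h := hp.comp (Sum.map_injective.2 ⟨Sum.inl_injective, Function.injective_id (α := C)⟩)
  convert h using 1
  ext (i | c) <;> rfl

lemma injective_withParams_snd (hp : Function.Injective (jointTuple C p)) :
    Function.Injective (withParams C p.2) := by
  have h := hp.comp (Sum.map_injective.2 ⟨Sum.inr_injective, Function.injective_id (α := C)⟩)
  convert h using 1
  ext (i | c) <;> rfl

/-- A stable definable relation is generically constant on products of cells. -/
lemma IsStable.mem_of_mem_orderCell [Fintype ι] [Fintype κ] [Nonempty ι] (hD : IsStable D)
    (hinv : ∀ p q, SameOrder (jointTuple C p) (jointTuple C q) → (p ∈ D ↔ q ∈ D))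
    (hp : Function.Injective (jointTuple C p)) (hq : Function.Injective (jointTuple C q))
    (hqp : q ∈ orderCell C p.1 ×ˢ orderCell C p.2) (hpD : p ∈ D) : q ∈ D := by
  by_contra hqD
  let f : Set ((ι → ℝ) × (κ → ℝ)) :=
    {x | ∀ᶠ y in nhds x, Function.Injective (jointTuple C y) → y ∈ D}
  let g : Set ((ι → ℝ) × (κ → ℝ)) :=
    {x | ∀ᶠ y in nhds x, Function.Injective (jointTuple C y) → y ∉ D}
  have hfg : orderCell C p.1 ×ˢ orderCell C p.2 ⊆ f ∪ g := by
    rintro x ⟨hx₁, hx₂⟩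
    have ha := injective_of_mem_orderCell (injective_withParams_fst hp) hx₁
    have hb := injective_of_mem_orderCell (injective_withParams_snd hp) hx₂
    obtain ⟨ε, hε, hx⟩ := eventually_sepNear C x
    by_cases h : ∃ y ∈ D, SepNear C ε x y ∧ Function.Injective (jointTuple C y)
    · obtain ⟨y, hyD, hy, hyi⟩ := h
      exact .inl (hx.mono fun w hw hwi =>
        hD.mem_of_near_of_injective hinv hε ha hb hy hw hyi hwi hyD)
    · exact .inr (hx.mono fun w hw hwi hwD => h ⟨w, hwD, hw, hwi⟩)
  have hpc : p ∈ orderCell C p.1 ×ˢ orderCell C p.2 := ⟨self_mem_orderCell, self_mem_orderCell⟩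
  have hpf : p ∈ f := (hfg hpc).resolve_right fun h => h.self_of_nhds hp hpD
  have hqg : q ∈ g := (hfg hqp).resolve_left fun h => hqD (h.self_of_nhds hq)
  obtain ⟨x, -, hxf, hxg⟩ := (convex_orderCell.prod convex_orderCell).isPreconnected f g
    isOpen_setOfPred_eventually_nhds isOpen_setOfPred_eventually_nhds hfg ⟨p, hpc, hpf⟩ ⟨q, hqp, hqg⟩
  have hdense : Dense {p : (ι → ℝ) × (κ → ℝ) | ¬ Function.Injective (jointTuple C p)}ᶜ := by
    refine dense_compl_of_dimH_lt_finrank ((dimH_not_injective_lt C).trans_eq ?_)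
    rw [Module.finrank_prod, Module.finrank_fintype_fun_eq_card,
      Module.finrank_fintype_fun_eq_card]
  obtain ⟨y, hy, hyi⟩ := mem_closure_iff_nhds.1 (hdense x) _ (hxf.and hxg)
  have hyi' : Function.Injective (jointTuple C y) := not_not.1 hyi
  exact hy.2 hyi' (hy.1 hyi')

end

theorem stmt5 (m n : ℕ) (hm : 1 ≤ m) (hn : 1 ≤ n)
    (X : Set (Fin m → ℝ)) (Y : Set (Fin n → ℝ)) (D : Set ((Fin m → ℝ) × (Fin n → ℝ)))
    (hX : Set.Definable (Set.univ : Set ℝ) Language.order X)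
    (hY : Set.Definable (Set.univ : Set ℝ) Language.order Y)
    (hDsub : D ⊆ X ×ˢ Y)
    (hD : Set.Definable (Set.univ : Set ℝ) Language.order (joinR m n ⁻¹' D))
    (hstable : IsStable D)
    (hdX : dimH X = (m : ℝ≥0∞)) (hdY : dimH Y = (n : ℝ≥0∞))
    (hdD : dimH D = ((m + n : ℕ) : ℝ≥0∞)) :
    ∃ (k : ℕ) (Xs : Fin k → Set (Fin m → ℝ)) (Ys : Fin k → Set (Fin n → ℝ)),
      (∀ i, Set.Definable (Set.univ : Set ℝ) Language.order (Xs i)) ∧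
      (∀ i, Set.Definable (Set.univ : Set ℝ) Language.order (Ys i)) ∧
      (∀ i, Xs i ⊆ X) ∧ (∀ i, Ys i ⊆ Y) ∧
      (∀ i, dimH (Xs i) = (m : ℝ≥0∞)) ∧ (∀ i, dimH (Ys i) = (n : ℝ≥0∞)) ∧
      dimH (symmDiff D (⋃ i, (Xs i) ×ˢ (Ys i))) < ((m + n : ℕ) : ℝ≥0∞) := by
  classical
  have : Nonempty (Fin m) := ⟨⟨0, hm⟩⟩
  obtain ⟨CX, hCX⟩ := hX.exists_params
  obtain ⟨CY, hCY⟩ := hY.exists_params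
  obtain ⟨CD, hCD⟩ := hD.exists_params
  obtain ⟨C, hXC, hYC, hDC⟩ : ∃ C, CX ⊆ C ∧ CY ⊆ C ∧ CD ⊆ C :=
    ⟨CX ∪ CY ∪ CD, by grind, by grind, by grind⟩
  have hinv : ∀ p q : (Fin m → ℝ) × (Fin n → ℝ),
      SameOrder (jointTuple C p) (jointTuple C q) → (p ∈ D ↔ q ∈ D) := by
    intro p q h
    have hjoin : ∀ p : (Fin m → ℝ) × (Fin n → ℝ), joinR m n (Fin.append p.1 p.2) = p := by
      intro p
      simp [joinR]
    have hcomp : ∀ p : (Fin m → ℝ) × (Fin n → ℝ), withParams C (Fin.append p.1 p.2) =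
        jointTuple C p ∘ Sum.map finSumFinEquiv.symm id := by
      intro p
      ext (i | c)
      · refine Fin.addCases (fun i => ?_) (fun j => ?_) i <;>
          simp [withParams, jointTuple]
      · rfl
    have := hCD C hDC (Fin.append p.1 p.2) (Fin.append q.1 q.2)
      (by rw [hcomp, hcomp]; exact h.comp _)
    simpa [hjoin] using this
  let S : Set (Set (Fin m → ℝ) × Set (Fin n → ℝ)) :=
    (fun p => (orderCell C p.1, orderCell C p.2)) ''
      {p | p ∈ D ∧ Function.Injective (jointTuple C p)}
  have hS : S.Finite := ((finite_range_orderCell C).prod (finite_range_orderCell C)).subset (by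
    rintro _ ⟨p, -, rfl⟩
    exact ⟨⟨p.1, rfl⟩, ⟨p.2, rfl⟩⟩)
  have := hS.to_subtype
  obtain ⟨k, ⟨e⟩⟩ := Finite.exists_equiv_fin S
  have hval : ∀ i, ∃ p ∈ D, Function.Injective (jointTuple C p) ∧
      (e.symm i).1 = (orderCell C p.1, orderCell C p.2) := by
    intro i
    obtain ⟨p, ⟨hp, hpi⟩, h⟩ := (e.symm i).2
    exact ⟨p, hp, hpi, h.symm⟩
  choose P hPD hPi hP using hval
  refine ⟨k, fun i => orderCell C (P i).1, fun i => orderCell C (P i).2,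
    fun i => definable_orderCell, fun i => definable_orderCell, fun i v hv => ?_,
    fun i v hv => ?_, fun i => ?_, fun i => ?_, ?_⟩
  · exact (hCX C hXC _ _ (sameOrder_of_mem_orderCell (injective_withParams_fst (hPi i)) hv)).1
      (hDsub (hPD i)).1
  · exact (hCY C hYC _ _ (sameOrder_of_mem_orderCell (injective_withParams_snd (hPi i)) hv)).1
      (hDsub (hPD i)).2
  · rw [dimH_orderCell, Fintype.card_fin]
  · rw [dimH_orderCell, Fintype.card_fin]
  · have hlt := dimH_not_injective_lt (ι := Fin m) (κ := Fin n) C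
    rw [Fintype.card_fin, Fintype.card_fin] at hlt
    refine (dimH_mono ?_).trans_lt hlt
    rintro q hq hqi
    rcases hq with ⟨hqD, hqU⟩ | ⟨hqU, hqD⟩
    · refine hqU (Set.mem_iUnion.2 ⟨e ⟨_, q, ⟨hqD, hqi⟩, rfl⟩, ?_⟩)
      have h := hP (e ⟨_, q, ⟨hqD, hqi⟩, rfl⟩)
      rw [e.symm_apply_apply, Prod.mk.injEq] at h
      dsimp only
      rw [← h.1, ← h.2]
      exact ⟨self_mem_orderCell, self_mem_orderCell⟩
    · obtain ⟨i, hi⟩ := Set.mem_iUnion.1 hqU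
      exact hqD (hstable.mem_of_mem_orderCell hinv (hPi i) hqi hi (hPD i))
end

section
/- Let m, n ≥ 1. Every set in the Boolean algebra of subsets of ℝ^m × ℝ^n generated by the special stable sets is a finite union of special stable sets. In particular, the complement in ℝ^m × ℝ^n of a special stable set is a finite union of special stable sets. -/
open Set MvPolynomial MeasureTheory
open scoped ENNReal

/-- Semialgebraic subsets of ℝ^k: the Boolean algebra generated by the sets
`{v | p v = 0}` and `{v | p v > 0}` for real polynomials `p`. -/
inductive Semialgebraic (k : ℕ) : Set (Fin k → ℝ) → Prop
  | zero (p : MvPolynomial (Fin k) ℝ) : Semialgebraic k {v | eval v p = 0}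
  | pos (p : MvPolynomial (Fin k) ℝ) : Semialgebraic k {v | 0 < eval v p}
  | compl {s : Set (Fin k → ℝ)} : Semialgebraic k s → Semialgebraic k sᶜ
  | union {s t : Set (Fin k → ℝ)} :
      Semialgebraic k s → Semialgebraic k t → Semialgebraic k (s ∪ t)

/-- Equationally definable subsets of ℝ^k: the Boolean algebra generated by real
algebraic sets `{v | p v = 0}`. -/
inductive EquationallyDefinable (k : ℕ) : Set (Fin k → ℝ) → Prop
  | zero (p : MvPolynomial (Fin k) ℝ) : EquationallyDefinable k {v | eval v p = 0}
  | compl {s : Set (Fin k → ℝ)} : EquationallyDefinable k s → EquationallyDefinable k sᶜ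
  | union {s t : Set (Fin k → ℝ)} :
      EquationallyDefinable k s → EquationallyDefinable k t →
      EquationallyDefinable k (s ∪ t)

/-- A subset of ℝ^m × ℝ^n is semialgebraic if the corresponding subset of ℝ^{m+n} is. -/
def SemialgebraicProd (m n : ℕ) (D : Set ((Fin m → ℝ) × (Fin n → ℝ))) : Prop :=
  Semialgebraic (m + n) (joinR m n ⁻¹' D)

/-- A subset of ℝ^m × ℝ^n is equationally definable if the corresponding subset of
ℝ^{m+n} is. -/
def EquationallyDefinableProd (m n : ℕ) (D : Set ((Fin m → ℝ) × (Fin n → ℝ))) : Prop :=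
  EquationallyDefinable (m + n) (joinR m n ⁻¹' D)

/-- `D ⊆ ℝ^m × ℝ^n` is special stable if `D = Z ∩ (X × Y)` with `Z` equationally
definable, `X ⊆ ℝ^m` and `Y ⊆ ℝ^n` semialgebraic. -/
def SpecialStable (m n : ℕ) (D : Set ((Fin m → ℝ) × (Fin n → ℝ))) : Prop :=
  ∃ (Z : Set ((Fin m → ℝ) × (Fin n → ℝ))) (X : Set (Fin m → ℝ)) (Y : Set (Fin n → ℝ)),
    EquationallyDefinableProd m n Z ∧ Semialgebraic m X ∧ Semialgebraic n Y ∧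
    D = Z ∩ X ×ˢ Y

/-- The Boolean algebra of subsets of ℝ^m × ℝ^n generated by the special stable sets. -/
inductive SpecialStableBC (m n : ℕ) : Set ((Fin m → ℝ) × (Fin n → ℝ)) → Prop
  | basic {D} : SpecialStable m n D → SpecialStableBC m n D
  | compl {D} : SpecialStableBC m n D → SpecialStableBC m n Dᶜ
  | union {D E} : SpecialStableBC m n D → SpecialStableBC m n E → SpecialStableBC m n (D ∪ E)

theorem Semialgebraic.univ (k : ℕ) : Semialgebraic k Set.univ := by
  simpa using Semialgebraic.zero (0 : MvPolynomial (Fin k) ℝ)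

theorem Semialgebraic.inter {k : ℕ} {s t : Set (Fin k → ℝ)} (hs : Semialgebraic k s)
    (ht : Semialgebraic k t) : Semialgebraic k (s ∩ t) := by
  simpa [Set.compl_union] using (hs.compl.union ht.compl).compl

theorem EquationallyDefinable.univ (k : ℕ) : EquationallyDefinable k Set.univ := by
  simpa using EquationallyDefinable.zero (0 : MvPolynomial (Fin k) ℝ)

theorem EquationallyDefinable.inter {k : ℕ} {s t : Set (Fin k → ℝ)}
    (hs : EquationallyDefinable k s) (ht : EquationallyDefinable k t) :
    EquationallyDefinable k (s ∩ t) := by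
  simpa [Set.compl_union] using (hs.compl.union ht.compl).compl

/-- The sets that are finite unions of special stable sets. -/
inductive FiniteUnionSpecialStable (m n : ℕ) : Set ((Fin m → ℝ) × (Fin n → ℝ)) → Prop
  | empty : FiniteUnionSpecialStable m n ∅
  | insert {D E} : SpecialStable m n D → FiniteUnionSpecialStable m n E →
      FiniteUnionSpecialStable m n (D ∪ E)

section SpecialStable

variable {m n : ℕ} {D E : Set ((Fin m → ℝ) × (Fin n → ℝ))}

theorem SpecialStable.inter (hD : SpecialStable m n D) (hE : SpecialStable m n E) :
    SpecialStable m n (D ∩ E) := by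
  obtain ⟨Z, X, Y, hZ, hX, hY, rfl⟩ := hD
  obtain ⟨Z', X', Y', hZ', hX', hY', rfl⟩ := hE
  refine ⟨Z ∩ Z', X ∩ X', Y ∩ Y', EquationallyDefinable.inter hZ hZ', hX.inter hX',
    hY.inter hY', ?_⟩
  rw [← Set.prod_inter_prod, Set.inter_inter_inter_comm]

theorem SpecialStable.univ : SpecialStable m n Set.univ :=
  ⟨Set.univ, Set.univ, Set.univ, EquationallyDefinable.univ _, Semialgebraic.univ _,
    Semialgebraic.univ _, by simp⟩

namespace FiniteUnionSpecialStable

theorem of_specialStable (hD : SpecialStable m n D) : FiniteUnionSpecialStable m n D := by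
  simpa using insert hD empty

theorem union (hD : FiniteUnionSpecialStable m n D) (hE : FiniteUnionSpecialStable m n E) :
    FiniteUnionSpecialStable m n (D ∪ E) := by
  induction hD with
  | empty => simpa using hE
  | insert h _ ih => rw [Set.union_assoc]; exact insert h ih

theorem inter_specialStable (hD : FiniteUnionSpecialStable m n D) (hE : SpecialStable m n E) :
    FiniteUnionSpecialStable m n (D ∩ E) := by
  induction hD with
  | empty => simpa using empty
  | insert h _ ih => rw [Set.union_inter_distrib_right]; exact insert (h.inter hE) ih

theorem inter (hD : FiniteUnionSpecialStable m n D) (hE : FiniteUnionSpecialStable m n E) :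
    FiniteUnionSpecialStable m n (D ∩ E) := by
  induction hE with
  | empty => simpa using empty
  | insert h _ ih =>
    rw [Set.inter_union_distrib_left]
    exact (hD.inter_specialStable h).union ih

theorem compl_specialStable (hD : SpecialStable m n D) :
    FiniteUnionSpecialStable m n Dᶜ := by
  obtain ⟨Z, X, Y, hZ, hX, hY, rfl⟩ := hD
  have hZ' : SpecialStable m n Zᶜ :=
    ⟨Zᶜ, Set.univ, Set.univ, EquationallyDefinable.compl hZ, Semialgebraic.univ _,
      Semialgebraic.univ _, by simp⟩
  have hX' : SpecialStable m n (Xᶜ ×ˢ Set.univ) :=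
    ⟨Set.univ, Xᶜ, Set.univ, EquationallyDefinable.univ _, hX.compl,
      Semialgebraic.univ _, by simp⟩
  have hY' : SpecialStable m n (Set.univ ×ˢ Yᶜ) :=
    ⟨Set.univ, Set.univ, Yᶜ, EquationallyDefinable.univ _, Semialgebraic.univ _,
      hY.compl, by simp⟩
  rw [Set.compl_inter, Set.compl_prod_eq_union]
  exact insert hZ' (insert hX' (of_specialStable hY'))

theorem compl (hD : FiniteUnionSpecialStable m n D) : FiniteUnionSpecialStable m n Dᶜ := by
  induction hD with
  | empty => simpa using of_specialStable SpecialStable.univ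
  | insert h _ ih => rw [Set.compl_union]; exact (compl_specialStable h).inter ih

theorem of_specialStableBC (hD : SpecialStableBC m n D) : FiniteUnionSpecialStable m n D := by
  induction hD with
  | basic h => exact of_specialStable h
  | compl _ ih => exact ih.compl
  | union _ _ ihD ihE => exact ihD.union ihE

theorem exists_eq_iUnion (hD : FiniteUnionSpecialStable m n D) :
    ∃ (k : ℕ) (S : Fin k → Set ((Fin m → ℝ) × (Fin n → ℝ))),
      (∀ i, SpecialStable m n (S i)) ∧ D = ⋃ i, S i := by
  induction hD with
  | empty => exact ⟨0, Fin.elim0, fun i => i.elim0, by simp⟩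
  | @insert D E h _ ih =>
    obtain ⟨k, S, hS, rfl⟩ := ih
    refine ⟨k + 1, Fin.cons D S, Fin.cases h hS, ?_⟩
    ext x
    simp

end FiniteUnionSpecialStable

end SpecialStable

theorem stmt6 (m n : ℕ) (hm : 1 ≤ m) (hn : 1 ≤ n) :
    (∀ D : Set ((Fin m → ℝ) × (Fin n → ℝ)), SpecialStableBC m n D →
      ∃ (k : ℕ) (S : Fin k → Set ((Fin m → ℝ) × (Fin n → ℝ))),
        (∀ i, SpecialStable m n (S i)) ∧ D = ⋃ i, S i) ∧
    (∀ D : Set ((Fin m → ℝ) × (Fin n → ℝ)), SpecialStable m n D →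
      ∃ (k : ℕ) (S : Fin k → Set ((Fin m → ℝ) × (Fin n → ℝ))),
        (∀ i, SpecialStable m n (S i)) ∧ Dᶜ = ⋃ i, S i) := by
  exact ⟨fun D hD => (FiniteUnionSpecialStable.of_specialStableBC hD).exists_eq_iUnion,
    fun D hD => (FiniteUnionSpecialStable.compl_specialStable hD).exists_eq_iUnion⟩
end

section
/- Let D ⊆ ℝ^m × ℝ^n and D' ⊆ ℝ^{m'} × ℝ^{n'}, and suppose there exists an equational isomorphism f : D' → D. If D is stable, then D' is stable. -/
open Set MvPolynomial MeasureTheory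
open scoped ENNReal

/-- A map defined on `P ⊆ ℝ^a` with values in ℝ^b is equationally definable if its graph
is an equationally definable subset of ℝ^{a+b}. -/
def EqDefMapOn (a b : ℕ) (P : Set (Fin a → ℝ)) (f : (Fin a → ℝ) → (Fin b → ℝ)) : Prop :=
  EquationallyDefinable (a + b)
    {v | (joinR a b v).1 ∈ P ∧ (joinR a b v).2 = f (joinR a b v).1}

/-- `f` is an equational isomorphism from `D' ⊆ ℝ^{m'} × ℝ^{n'}` to `D ⊆ ℝ^m × ℝ^n`. -/
def IsEquationalIso (m n m' n' : ℕ)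
    (D : Set ((Fin m → ℝ) × (Fin n → ℝ))) (D' : Set ((Fin m' → ℝ) × (Fin n' → ℝ)))
    (f : (Fin m' → ℝ) × (Fin n' → ℝ) → (Fin m → ℝ) × (Fin n → ℝ)) : Prop :=
  ∃ (k : ℕ) (U : Fin k → Set ((Fin m → ℝ) × (Fin n → ℝ)))
    (U' : Fin k → Set ((Fin m' → ℝ) × (Fin n' → ℝ)))
    (fx : Fin k → (Fin m' → ℝ) → (Fin m → ℝ))
    (fy : Fin k → (Fin n' → ℝ) → (Fin n → ℝ)),
    (D ⊆ ⋃ i, U i) ∧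
    (∀ i, EquationallyDefinableProd m n (U i)) ∧
    (D' ⊆ ⋃ i, U' i) ∧
    (∀ i, EquationallyDefinableProd m' n' (U' i)) ∧
    (∀ i, EqDefMapOn m' m (Prod.fst '' U' i) (fx i)) ∧
    (∀ i, Set.MapsTo (fx i) (Prod.fst '' U' i) (Prod.fst '' U i)) ∧
    (∀ i, EqDefMapOn n' n (Prod.snd '' U' i) (fy i)) ∧
    (∀ i, Set.MapsTo (fy i) (Prod.snd '' U' i) (Prod.snd '' U i)) ∧
    (∀ i, Prod.map (fx i) (fy i) '' U' i = U i) ∧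
    (∀ i, Prod.map (fx i) (fy i) '' (U' i ∩ D') = U i ∩ D) ∧
    (∀ i, Set.EqOn f (Prod.map (fx i) (fy i)) (U' i ∩ D')) ∧
    (∀ i, Set.InjOn (Prod.map (fx i) (fy i)) (U' i))

/-- A stable relation cannot hold eventually along a filter in one order of iteration while failing
eventually in the other order. -/
theorem IsStable.not_iterated_eventually {S T ι : Type*} {D : Set (S × T)} (hD : IsStable D)
    (F : Filter ι) [F.NeBot] (a : ι → S) (b : ι → T)
    (h : ∀ᶠ i in F, ∀ᶠ j in F, (a i, b j) ∈ D)
    (h' : ∀ᶠ j in F, ∀ᶠ i in F, (a i, b j) ∉ D) : False := by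
  obtain ⟨g, hg, hr⟩ := exists_seq_of_forall_finset_exists
    (fun p : ι × ι => (∀ᶠ j in F, (a p.1, b j) ∈ D) ∧ (∀ᶠ i in F, (a i, b p.2) ∉ D) ∧
      (a p.1, b p.2) ∈ D)
    (fun p q => (a p.1, b q.2) ∈ D ∧ (a q.1, b p.2) ∉ D) (by
      intro s hs
      have hi : ∀ᶠ i in F, ∀ p ∈ s, (a i, b p.2) ∉ D :=
        (Filter.eventually_all_finset s).2 fun p hp => (hs p hp).2.1
      obtain ⟨i, hi₁, hi₂⟩ := (h.and hi).exists
      have hj : ∀ᶠ j in F, ∀ p ∈ s, (a p.1, b j) ∈ D :=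
        (Filter.eventually_all_finset s).2 fun p hp => (hs p hp).1
      obtain ⟨j, ⟨hj₁, hj₂⟩, hj₃⟩ := ((h'.and hj).and hi₁).exists
      exact ⟨(i, j), ⟨hi₁, hj₁, hj₃⟩, fun p hp => ⟨hj₂ p hp, hi₂ p hp⟩⟩)
  refine hD ⟨fun n => a (g n).1, fun n => b (g n).2, fun i j => ⟨fun hij => ?_, fun hij => ?_⟩⟩
  · by_contra! hlt
    exact (hr j i hlt).2 hij
  · rcases hij.eq_or_lt with rfl | hlt
    · exact (hg i).2.2
    · exact (hr i j hlt).1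

/-- By the Hilbert basis theorem, iterated eventual vanishing of a family of polynomials along a
family of points does not depend on the order of iteration. -/
theorem MvPolynomial.eventually_eventually_eval_eq_zero {ι τ K : Type*} [Finite τ] [Field K]
    {F : Filter ι} (q : ι → MvPolynomial τ K) (y : ι → τ → K)
    (h : ∀ᶠ i in F, ∀ᶠ j in F, eval (y j) (q i) = 0) :
    ∀ᶠ j in F, ∀ᶠ i in F, eval (y j) (q i) = 0 := by
  set A : Set ι := {i | ∀ᶠ j in F, eval (y j) (q i) = 0}
  obtain ⟨s, hs, hspan⟩ := Submodule.fg_span_iff_fg_span_finset_subset (q '' A) |>.1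
    (IsNoetherian.noetherian (Submodule.span (MvPolynomial τ K) (q '' A)))
  have hev : ∀ᶠ j in F, ∀ p ∈ s, eval (y j) p = 0 := by
    refine (Filter.eventually_all_finset s).2 fun p hp => ?_
    obtain ⟨i, hi, rfl⟩ := hs hp
    exact hi
  filter_upwards [hev] with j hj
  filter_upwards [h] with i hi
  have hmem : q i ∈ Ideal.span (s : Set (MvPolynomial τ K)) := by
    change q i ∈ Submodule.span (MvPolynomial τ K) (s : Set (MvPolynomial τ K))
    rw [← hspan]
    exact Submodule.subset_span ⟨i, hi, rfl⟩
  have hle : Ideal.span (s : Set (MvPolynomial τ K)) ≤ RingHom.ker (eval (y j)) :=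
    Ideal.span_le.2 hj
  exact hle hmem

/-- Iterated ultrafilter limits of membership in an equationally definable set commute. -/
theorem EquationallyDefinable.eventually_eventually_comm {m n : ℕ} {s : Set (Fin (m + n) → ℝ)}
    (hs : EquationallyDefinable (m + n) s) {ι : Type*} (F : Ultrafilter ι)
    (a : ι → Fin m → ℝ) (b : ι → Fin n → ℝ) :
    (∀ᶠ i in F, ∀ᶠ j in F, Fin.append (a i) (b j) ∈ s) ↔
      ∀ᶠ j in F, ∀ᶠ i in F, Fin.append (a i) (b j) ∈ s := by
  induction hs with
  | zero p =>
    let q (i : ι) : MvPolynomial (Fin n) ℝ :=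
      bind₁ (Fin.append (fun k => C (a i k)) X) p
    let r (j : ι) : MvPolynomial (Fin m) ℝ :=
      bind₁ (Fin.append X (fun k => C (b j k))) p
    have hq (i j : ι) : eval (b j) (q i) = eval (Fin.append (a i) (b j)) p := by
      simp only [q, eval, eval₂Hom_bind₁]
      congr 2
      funext k
      refine Fin.addCases (fun k => ?_) (fun k => ?_) k <;> simp
    have hr (i j : ι) : eval (a i) (r j) = eval (Fin.append (a i) (b j)) p := by
      simp only [r, eval, eval₂Hom_bind₁]
      congr 2
      funext k
      refine Fin.addCases (fun k => ?_) (fun k => ?_) k <;> simp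
    refine ⟨fun h => ?_, fun h => ?_⟩
    · simpa only [hq, Set.mem_ofPred_eq] using
        MvPolynomial.eventually_eventually_eval_eq_zero (F := F) q b
          (by simpa only [hq, Set.mem_ofPred_eq] using h)
    · simpa only [hr, Set.mem_ofPred_eq] using
        MvPolynomial.eventually_eventually_eval_eq_zero (F := F) r a
          (by simpa only [hr, Set.mem_ofPred_eq] using h)
  | compl _ ih => simpa only [Set.mem_compl_iff, Ultrafilter.eventually_not] using not_congr ih
  | union _ _ ih₁ ih₂ =>
    simpa only [Set.mem_union, Ultrafilter.eventually_or] using or_congr ih₁ ih₂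

theorem EquationallyDefinableProd.eventually_eventually_comm {m n : ℕ}
    {U : Set ((Fin m → ℝ) × (Fin n → ℝ))} (hU : EquationallyDefinableProd m n U) {ι : Type*}
    (F : Ultrafilter ι) (a : ι → Fin m → ℝ) (b : ι → Fin n → ℝ) :
    (∀ᶠ i in F, ∀ᶠ j in F, (a i, b j) ∈ U) ↔ ∀ᶠ j in F, ∀ᶠ i in F, (a i, b j) ∈ U := by
  simpa [joinR] using EquationallyDefinable.eventually_eventually_comm hU F a b

theorem Ultrafilter.eventually_exists_of_finite {ι κ : Type*} [Finite κ] (F : Ultrafilter ι)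
    {p : κ → ι → Prop} (h : ∀ᶠ i in F, ∃ k, p k i) : ∃ k, ∀ᶠ i in F, p k i := by
  by_contra! hne
  obtain ⟨i, ⟨k, hk⟩, hi⟩ :=
    (h.and (Filter.eventually_all.2 hne)).exists
  exact hi k hk

theorem stmt7 (m n m' n' : ℕ)
    (D : Set ((Fin m → ℝ) × (Fin n → ℝ))) (D' : Set ((Fin m' → ℝ) × (Fin n' → ℝ)))
    (f : (Fin m' → ℝ) × (Fin n' → ℝ) → (Fin m → ℝ) × (Fin n → ℝ))
    (hf : IsEquationalIso m n m' n' D D' f) (hD : IsStable D) :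
    IsStable D' := by
  obtain ⟨k, U, U', fx, fy, -, -, hcov, hU', -, -, -, -, himg, himgD, -, hinj⟩ := hf
  rintro ⟨a, b, hab⟩
  let F : Ultrafilter ℕ := Filter.hyperfilter ℕ
  have hF : (F : Filter ℕ) ≤ Filter.atTop := Nat.hyperfilter_le_atTop
  have hcover : ∀ᶠ i in F, ∃ l, ∀ᶠ j in F, (a i, b j) ∈ U' l := by
    refine Filter.Eventually.of_forall fun i => F.eventually_exists_of_finite ?_
    filter_upwards [hF (Filter.eventually_ge_atTop i)] with j hj
    exact mem_iUnion.1 (hcov ((hab i j).2 hj))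
  obtain ⟨l, hl⟩ := F.eventually_exists_of_finite hcover
  have hl' := ((hU' l).eventually_eventually_comm F a b).1 hl
  have hiff {i j : ℕ} (hij : (a i, b j) ∈ U' l) : (fx l (a i), fy l (b j)) ∈ D ↔ i ≤ j := by
    rw [← hab i j]
    constructor
    · intro h
      have hmem : Prod.map (fx l) (fy l) (a i, b j) ∈ U l ∩ D :=
        ⟨himg l ▸ mem_image_of_mem _ hij, h⟩
      rw [← himgD l] at hmem
      obtain ⟨z, hz, hzeq⟩ := hmem
      exact hinj l hz.1 hij hzeq ▸ hz.2
    · intro h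
      have hmem : Prod.map (fx l) (fy l) (a i, b j) ∈ U l ∩ D :=
        himgD l ▸ mem_image_of_mem _ ⟨hij, h⟩
      exact hmem.2
  refine hD.not_iterated_eventually (F : Filter ℕ) (fun i => fx l (a i)) (fun j => fy l (b j))
    ?_ ?_
  · filter_upwards [hl] with i hi
    filter_upwards [hi, hF (Filter.eventually_ge_atTop i)] with j hj hij
    exact (hiff hj).2 hij
  · filter_upwards [hl'] with j hj
    filter_upwards [hj, hF (Filter.eventually_gt_atTop j)] with i hi hij h
    exact absurd ((hiff hi).1 h) (not_le.2 hij)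
end

section
/- Let n ≥ 2 and let U ⊆ ℝ^n be a connected open semialgebraic set. Then for every semialgebraic set C ⊆ U with dimH(C) ≤ n − 2, the set U \ C is connected. -/
open Set MvPolynomial MeasureTheory
open scoped ENNReal

open Filter Topology in
/-- In a convex open subset of a space of dimension `d + 1`, two distinct points off a
set of Hausdorff dimension less than `d` are joined off that set by a path of two segments. -/
theorem exists_two_segments_subset_diff {E : Type*} [NormedAddCommGroup E] [NormedSpace ℝ E]
    [FiniteDimensional ℝ E] {B C : Set E} (hB : IsOpen B) (hBc : Convex ℝ B)
    (hC : dimH C + 1 < Module.finrank ℝ E) {x y : E} (hx : x ∈ B \ C) (hy : y ∈ B \ C)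
    (hxy : x ≠ y) :
    ∃ z, segment ℝ x z ⊆ B \ C ∧ segment ℝ y z ⊆ B \ C := by
  obtain ⟨f, hf⟩ := SeparatingDual.exists_eq_one (R := ℝ) (sub_ne_zero.2 hxy.symm)
  set K : Submodule ℝ E := LinearMap.ker (f : E →ₗ[ℝ] ℝ)
  have hdimK : Module.finrank ℝ K + 1 = Module.finrank ℝ E := by
    apply Module.Dual.finrank_ker_add_one_of_ne_zero
    intro h
    have := congrArg (fun g : E →ₗ[ℝ] ℝ => g (y - x)) h
    simp [hf] at this
  have hCK : dimH C < Module.finrank ℝ K := by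
    rw [← hdimK] at hC
    push_cast at hC
    exact lt_of_add_lt_add_right hC
  have key : ∀ (p w : E) (e : ℝ),
      dimH ((↑) ⁻¹' ((fun c => (e * f (c - p))⁻¹ • (c - p) + w) ''
        (C ∩ {c | 0 < e * f (c - p)})) : Set K) < Module.finrank ℝ K := by
    intro p w e
    refine lt_of_le_of_lt ?_ hCK
    rw [← (isometry_subtype_coe (s := (K : Set E))).dimH_image]
    refine (dimH_mono (image_preimage_subset _ _)).trans ?_
    refine (ContDiffOn.dimH_image_le (s := {c | 0 < e * f (c - p)}) ?_ ?_
      inter_subset_right).trans (dimH_mono inter_subset_left)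
    · refine ContDiffOn.add (ContDiffOn.smul (ContDiffOn.inv ?_ ?_) ?_) contDiffOn_const
      · fun_prop
      · exact fun c hc => ne_of_gt hc
      · fun_prop
    · have : {c | 0 < e * f (c - p)} = {c | e * f p < (e • f) c} := by
        ext c
        simp [mul_sub]
      rw [this]
      exact convex_halfSpace_gt (e • f).toLinearMap.isLinear _
  have hdense := dense_compl_of_dimH_lt_finrank (E := K) (s := _ ∪ _)
    ((dimH_union _ _).trans_lt (max_lt (key x (-(y - x)) 1) (key y (y - x) (-1))))
  have hmid : x + (2⁻¹ : ℝ) • ((y - x) + (0 : E)) ∈ B := by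
    convert hBc.midpoint_mem hx.1 hy.1 using 1
    rw [midpoint_eq_smul_add]
    simp only [invOf_eq_inv]
    module
  have hcont : Continuous fun k : K => x + (2⁻¹ : ℝ) • ((y - x) + (k : E)) := by fun_prop
  obtain ⟨k, hkB, hk⟩ := hdense.inter_open_nonempty _ (hB.preimage hcont) ⟨0, by simpa using hmid⟩
  have hfk : f (k : E) = 0 := k.2
  simp only [mem_preimage] at hkB
  refine ⟨_, fun c hc => ⟨hBc.segment_subset hx.1 hkB hc, fun hcC => hk (Or.inl ?_)⟩,
    fun c hc => ⟨hBc.segment_subset hy.1 hkB hc, fun hcC => hk (Or.inr ?_)⟩⟩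
  · rw [segment_eq_image'] at hc
    obtain ⟨t, ht, rfl⟩ := hc
    have ht0 : 0 < t := by
      refine ht.1.lt_of_ne' ?_
      rintro rfl
      exact hx.2 (by simpa using hcC)
    refine ⟨_, ⟨hcC, ?_⟩, ?_⟩
    · simp [hfk, hf, map_add, ht0, -map_sub]
    · simp only [add_sub_cancel_left, map_smul, map_add, hfk, hf, smul_eq_mul, smul_smul]
      match_scalars <;> field_simp <;> ring
  · rw [segment_eq_image'] at hc
    obtain ⟨t, ht, rfl⟩ := hc
    have ht0 : 0 < t := by
      refine ht.1.lt_of_ne' ?_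
      rintro rfl
      exact hy.2 (by simpa using hcC)
    have hz : x + (2⁻¹ : ℝ) • ((y - x) + (k : E)) - y
        = (2⁻¹ : ℝ) • (-(y - x) + (k : E)) := by module
    simp only [hz] at hcC ⊢
    refine ⟨_, ⟨hcC, ?_⟩, ?_⟩
    · simp [hfk, hf, map_add, map_neg, ht0, -map_sub, -neg_sub]
    · simp only [add_sub_cancel_left, map_smul, map_add, map_neg, hfk, hf, smul_eq_mul, smul_smul]
      match_scalars <;> field_simp <;> ring

/-- Removing a set of Hausdorff dimension less than `d` from a convex open subset of a space of
dimension `d + 1` leaves a preconnected set. -/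
theorem Convex.isPreconnected_diff_of_dimH {E : Type*} [NormedAddCommGroup E] [NormedSpace ℝ E]
    [FiniteDimensional ℝ E] {B C : Set E} (hB : IsOpen B) (hBc : Convex ℝ B)
    (hC : dimH C + 1 < Module.finrank ℝ E) : IsPreconnected (B \ C) := by
  refine isPreconnected_of_forall_pair fun x hx y hy => ?_
  by_cases hxy : x = y
  · subst hxy
    exact ⟨{x}, by simpa using hx, rfl, rfl, isPreconnected_singleton⟩
  · obtain ⟨z, hxz, hyz⟩ := exists_two_segments_subset_diff hB hBc hC hx hy hxy
    exact ⟨segment ℝ x z ∪ segment ℝ y z, union_subset hxz hyz, Or.inl (left_mem_segment ℝ x z),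
      Or.inr (left_mem_segment ℝ y z),
      (convex_segment x z).isPreconnected.union z (right_mem_segment ℝ x z)
        (right_mem_segment ℝ y z) (convex_segment y z).isPreconnected⟩

open Filter Topology in
/-- Removing a set of Hausdorff dimension less than `d` from a connected open subset of a space of
dimension `d + 1` leaves a connected set. -/
theorem IsConnected.diff_of_dimH {E : Type*} [NormedAddCommGroup E] [NormedSpace ℝ E]
    [FiniteDimensional ℝ E] {U C : Set E} (hU : IsOpen U) (hUc : IsConnected U)
    (hC : dimH C + 1 < Module.finrank ℝ E) : IsConnected (U \ C) := by
  have hdense : Dense Cᶜ := dense_compl_of_dimH_lt_finrank (lt_of_le_of_lt le_self_add hC)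
  refine ⟨hdense.inter_open_nonempty U hU hUc.nonempty, ?_⟩
  let J : E → E → Prop := fun a b => ∃ t ⊆ U \ C, a ∈ t ∧ b ∈ t ∧ IsPreconnected t
  let P : E → E → Prop := fun p q => ∀ᶠ a in 𝓝[Cᶜ] p, ∀ᶠ b in 𝓝[Cᶜ] q, J a b
  have hloc : ∀ p ∈ U, ∀ᶠ q in 𝓝[U] p, P p q ∧ P q p := by
    intro p hp
    obtain ⟨r, hr, hball⟩ := Metric.isOpen_iff.1 hU p hp
    have hJ : ∀ a ∈ Metric.ball p r \ C, ∀ b ∈ Metric.ball p r \ C, J a b := fun a ha b hb =>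
      ⟨_, sdiff_subset_sdiff_left hball, ha, hb,
        (convex_ball p r).isPreconnected_diff_of_dimH Metric.isOpen_ball hC⟩
    have hev : ∀ q ∈ Metric.ball p r, ∀ᶠ a in 𝓝[Cᶜ] q, a ∈ Metric.ball p r \ C := fun q hq =>
      inter_mem (mem_nhdsWithin_of_mem_nhds (Metric.isOpen_ball.mem_nhds hq)) self_mem_nhdsWithin
    have hP : ∀ q ∈ Metric.ball p r, ∀ q' ∈ Metric.ball p r, P q q' := fun q hq q' hq' =>
      (hev q hq).mono fun a ha => (hev q' hq').mono fun b hb => hJ a ha b hb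
    have hpp := Metric.mem_ball_self (x := p) hr
    filter_upwards [mem_nhdsWithin_of_mem_nhds (Metric.ball_mem_nhds p hr)] with q hq
    exact ⟨hP p hpp q hq, hP q hq p hpp⟩
  have htrans : ∀ p q r, P p q → P q r → P p r := by
    intro p q r hpq hqr
    have : (𝓝[Cᶜ] q).NeBot := mem_closure_iff_nhdsWithin_neBot.1 (hdense q)
    filter_upwards [hpq] with a ha
    obtain ⟨b, ⟨t, ht, hat, hbt, htc⟩, hb⟩ := (ha.and hqr).exists
    filter_upwards [hb] with c ⟨s, hs, hbs, hcs, hsc⟩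
    exact ⟨t ∪ s, union_subset ht hs, Or.inl hat, Or.inr hcs, htc.union b hbt hbs hsc⟩
  refine isPreconnected_of_forall_pair fun a ha b hb => ?_
  have hab : P a b := hUc.isPreconnected.induction₂' P hloc
    (fun _ _ _ _ _ _ => htrans _ _ _) ha.1 hb.1
  exact (hab.self_of_nhdsWithin ha.2).self_of_nhdsWithin hb.2

theorem stmt8 (n : ℕ) (hn : 2 ≤ n) (U : Set (Fin n → ℝ))
    (hU : Semialgebraic n U) (hUopen : IsOpen U) (hUconn : IsConnected U)
    (C : Set (Fin n → ℝ)) (hC : Semialgebraic n C) (hCU : C ⊆ U)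
    (hdim : dimH C ≤ (n : ℝ≥0∞) - 2) :
    IsConnected (U \ C) := by
  refine hUconn.diff_of_dimH hUopen ?_
  rw [Module.finrank_fin_fun]
  obtain ⟨m, rfl⟩ := Nat.exists_eq_add_of_le' hn
  have h : ((m + 2 : ℕ) : ℝ≥0∞) - 2 = m := by
    push_cast
    exact ENNReal.add_sub_cancel_right (by simp)
  rw [h] at hdim
  calc dimH C + 1 ≤ m + 1 := by gcongr
    _ = ((m + 1 : ℕ) : ℝ≥0∞) := by push_cast; rfl
    _ < ((m + 2 : ℕ) : ℝ≥0∞) := by exact_mod_cast Nat.lt_succ_self _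
end

section
/- Every semialgebraic set D ⊆ ℝ × ℝ with dimH(D) ≤ 1 is stable (with respect to the decomposition of ℝ² as ℝ × ℝ). -/
open Set MvPolynomial MeasureTheory
open scoped ENNReal

/-- Away from the zero locus of some nonzero polynomial, a semialgebraic set is clopen. -/
theorem Semialgebraic.exists_isOpen_diff_zeroLocus {k : ℕ} {s : Set (Fin k → ℝ)}
    (hs : Semialgebraic k s) :
    ∃ p : MvPolynomial (Fin k) ℝ, p ≠ 0 ∧
      IsOpen (s ∩ {v | eval v p ≠ 0}) ∧ IsOpen (sᶜ ∩ {v | eval v p ≠ 0}) := by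
  have hne (p : MvPolynomial (Fin k) ℝ) : IsOpen {v | eval v p ≠ 0} :=
    isOpen_ne_fun (MvPolynomial.continuous_eval p) continuous_const
  induction hs with
  | zero p =>
    by_cases hp : p = 0
    · exact ⟨1, one_ne_zero, by simp [hp], by simp [hp]⟩
    · refine ⟨p, hp, ?_, ?_⟩
      · have : {v | eval v p = 0} ∩ {v | eval v p ≠ 0} = ∅ := inter_compl_self _
        simp [this]
      · exact (inter_self {v | eval v p ≠ 0}).symm ▸ hne p
  | pos p =>
    by_cases hp : p = 0
    · exact ⟨1, one_ne_zero, by simp [hp], by simp [hp]⟩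
    · refine ⟨p, hp, ?_, ?_⟩
      · exact (isOpen_lt continuous_const (MvPolynomial.continuous_eval p)).inter (hne p)
      · have : {v | 0 < eval v p}ᶜ ∩ {v | eval v p ≠ 0} = {v | eval v p < 0} := by
          ext v
          simpa using lt_iff_le_and_ne.symm
        rw [this]
        exact isOpen_lt (MvPolynomial.continuous_eval p) continuous_const
  | compl _ ih =>
    obtain ⟨p, hp, h₁, h₂⟩ := ih
    exact ⟨p, hp, h₂, by rwa [compl_compl]⟩
  | @union s t _ _ ihs iht =>
    obtain ⟨p, hp, hs₁, hs₂⟩ := ihs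
    obtain ⟨q, hq, ht₁, ht₂⟩ := iht
    refine ⟨p * q, mul_ne_zero hp hq, ?_, ?_⟩
    · convert (hs₁.inter (hne q)).union (ht₁.inter (hne p)) using 1
      ext v
      simp only [mem_inter_iff, mem_union, mem_ofPred_eq, map_mul, mul_ne_zero_iff]
      tauto
    · convert hs₂.inter ht₂ using 1
      ext v
      simp only [mem_inter_iff, mem_union, mem_compl_iff, mem_ofPred_eq, map_mul,
        mul_ne_zero_iff]
      tauto

/-- A semialgebraic set with empty interior lies in the zero locus of a nonzero polynomial. -/
theorem Semialgebraic.exists_subset_zeroLocus {k : ℕ} {s : Set (Fin k → ℝ)}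
    (hs : Semialgebraic k s) (hint : interior s = ∅) :
    ∃ p : MvPolynomial (Fin k) ℝ, p ≠ 0 ∧ ∀ v ∈ s, eval v p = 0 := by
  obtain ⟨p, hp, ho, -⟩ := hs.exists_isOpen_diff_zeroLocus
  refine ⟨p, hp, fun v hv => ?_⟩
  by_contra h
  have : v ∈ interior s := interior_maximal inter_subset_left ho ⟨hv, h⟩
  simp [hint] at this

/-- A bivariate polynomial whose zero locus contains half of an infinite grid vanishes. -/
theorem MvPolynomial.eq_zero_of_eval_halfGrid {R : Type*} [CommRing R] [IsDomain R]
    (p : MvPolynomial (Fin 2) R) {x y : ℕ → R} (hx : Function.Injective x)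
    (hy : Function.Injective y) (h : ∀ i j, i ≤ j → eval ![x i, y j] p = 0) : p = 0 := by
  have hline (i : ℕ) (z : R) : eval ![x i, z] p = 0 := by
    let q : Polynomial R := aeval ![Polynomial.C (x i), Polynomial.X] p
    have hq (w : R) : q.eval w = eval ![x i, w] p := by
      rw [← Polynomial.coe_aeval_eq_eval, ← MvPolynomial.coe_aeval_eq_eval]
      change Polynomial.aeval w (aeval _ p) = aeval _ p
      rw [← AlgHom.comp_apply, MvPolynomial.comp_aeval]
      congr 2
      ext k
      fin_cases k <;> simp
    have hq0 : q = 0 := Polynomial.eq_zero_of_infinite_isRoot q <|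
      ((Set.Ici_infinite i).image hy.injOn).mono <| by
        rintro _ ⟨j, hj, rfl⟩
        exact (hq _).trans (h i j hj)
    rw [← hq, hq0, Polynomial.eval_zero]
  have : Infinite R := Infinite.of_injective x hx
  refine MvPolynomial.funext_set ![range x, univ] ?_ ?_
  · intro k
    fin_cases k
    · exact infinite_range_of_injective hx
    · exact infinite_univ
  · intro v hv
    obtain ⟨i, hi⟩ : v 0 ∈ range x := hv 0 (mem_univ _)
    have hv : v = ![x i, v 1] := by
      ext k
      fin_cases k <;> simp [hi]
    rw [map_zero, hv, hline]

theorem stmt11 (D : Set ((Fin 1 → ℝ) × (Fin 1 → ℝ)))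
    (hD : SemialgebraicProd 1 1 D) (hdim : dimH D ≤ (1 : ℝ≥0∞)) :
    IsStable D := by
  rintro ⟨a, b, hab⟩
  have ha : Function.Injective a := fun i j hij =>
    le_antisymm ((hab i j).1 (hij ▸ (hab j j).2 le_rfl))
      ((hab j i).1 (hij ▸ (hab i i).2 le_rfl))
  have hb : Function.Injective b := fun i j hij =>
    le_antisymm ((hab i j).1 (hij ▸ (hab i i).2 le_rfl))
      ((hab j i).1 (hij ▸ (hab j j).2 le_rfl))
  have hDint : interior D = ∅ := by
    by_contra hne
    have h2 := Real.dimH_of_nonempty_interior (nonempty_iff_ne_empty.2 hne)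
    simp only [Module.finrank_prod, Module.finrank_fin_fun] at h2
    rw [h2] at hdim
    norm_num at hdim
  have hpair (x y : Fin 1 → ℝ) : joinR 1 1 ![x 0, y 0] = (x, y) := by
    ext k <;> fin_cases k <;> rfl
  have hsec : Continuous fun q : (Fin 1 → ℝ) × (Fin 1 → ℝ) => ![q.1 0, q.2 0] := by
    fun_prop
  have hint : interior (joinR 1 1 ⁻¹' D) = ∅ := by
    refine eq_empty_of_forall_notMem fun v hv => ?_
    have hsub : (fun q : (Fin 1 → ℝ) × (Fin 1 → ℝ) => ![q.1 0, q.2 0]) ⁻¹'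
        interior (joinR 1 1 ⁻¹' D) ⊆ interior D := by
      refine interior_maximal (fun q hq => ?_) (isOpen_interior.preimage hsec)
      have := interior_subset hq
      rwa [mem_preimage, hpair] at this
    have hmem : (fun _ => v 0, fun _ => v 1) ∈ interior D := hsub <| by
      rw [mem_preimage]
      convert hv using 1
      ext k
      fin_cases k <;> rfl
    simp [hDint] at hmem
  obtain ⟨p, hp, hpD⟩ := Semialgebraic.exists_subset_zeroLocus hD hint
  have hfun {u w : Fin 1 → ℝ} (h : u 0 = w 0) : u = w := by
    ext k
    rwa [Subsingleton.elim k 0]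
  refine hp (MvPolynomial.eq_zero_of_eval_halfGrid p (x := fun i => a i 0) (y := fun j => b j 0)
    (fun i j h => ha (hfun h)) (fun i j h => hb (hfun h)) fun i j hij => hpD _ ?_)
  rw [mem_preimage, hpair]
  exact (hab i j).2 hij
end

section
/- Let m, n ≥ 1, let Z ⊆ ℝ^m × ℝ^n be an equationally definable set, and let X ⊆ ℝ^m and Y ⊆ ℝ^n be arbitrary subsets. Then Z ∩ (X × Y) is stable. In particular, every special stable set is stable, and every finite union of special stable sets is stable. -/
open Set MvPolynomial MeasureTheory
open scoped ENNReal

/-- Grothendieck's double limit condition for `D`, along a fixed nonprincipal ultrafilter. -/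
def IteratedLimitsCommute {S T : Type*} (D : Set (S × T)) : Prop :=
  ∀ (a : ℕ → S) (b : ℕ → T),
    (∀ᶠ i in (Filter.hyperfilter ℕ : Filter ℕ), ∀ᶠ j in (Filter.hyperfilter ℕ : Filter ℕ),
      (a i, b j) ∈ D) ↔
    (∀ᶠ j in (Filter.hyperfilter ℕ : Filter ℕ), ∀ᶠ i in (Filter.hyperfilter ℕ : Filter ℕ),
      (a i, b j) ∈ D)

namespace IteratedLimitsCommute

variable {S T : Type*} {D E : Set (S × T)}

theorem compl (hD : IteratedLimitsCommute D) : IteratedLimitsCommute Dᶜ := fun a b => by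
  simpa only [mem_compl_iff, Ultrafilter.eventually_not] using not_congr (hD a b)

theorem union (hD : IteratedLimitsCommute D) (hE : IteratedLimitsCommute E) :
    IteratedLimitsCommute (D ∪ E) := fun a b => by
  simpa only [mem_union, Ultrafilter.eventually_or] using or_congr (hD a b) (hE a b)

theorem inter (hD : IteratedLimitsCommute D) (hE : IteratedLimitsCommute E) :
    IteratedLimitsCommute (D ∩ E) := fun a b => by
  simpa only [mem_inter_iff, Filter.eventually_and] using and_congr (hD a b) (hE a b)

theorem prod (X : Set S) (Y : Set T) : IteratedLimitsCommute (X ×ˢ Y) := fun a b => by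
  simp only [mem_prod, Filter.eventually_and, Filter.eventually_const]

theorem iUnion {k : ℕ} {F : Fin k → Set (S × T)} (hF : ∀ i, IteratedLimitsCommute (F i)) :
    IteratedLimitsCommute (⋃ i, F i) := by
  induction k with
  | zero => intro a b; simp
  | succ k ih =>
    have : ⋃ i, F i = F 0 ∪ ⋃ i : Fin k, F i.succ := by
      ext x; simp [Fin.exists_fin_succ]
    rw [this]
    exact (hF 0).union (ih fun i => hF i.succ)

theorem isStable (hD : IteratedLimitsCommute D) : IsStable D := by
  rintro ⟨a, b, h⟩
  have hlim : ∀ {P : ℕ → Prop}, (∀ᶠ i in Filter.atTop, P i) →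
      ∀ᶠ i in (Filter.hyperfilter ℕ : Filter ℕ), P i :=
    fun hP => Nat.hyperfilter_le_atTop hP
  have hab := (hD a b).1 <| .of_forall fun i =>
    hlim <| (Filter.eventually_ge_atTop i).mono fun j hj => (h i j).2 hj
  obtain ⟨j, hj⟩ := hab.exists
  obtain ⟨i, hij, hlt⟩ := (hj.and (hlim (Filter.eventually_gt_atTop j))).exists
  exact absurd ((h i j).1 hij) (not_le.2 hlt)

end IteratedLimitsCommute

/-- By the Hilbert basis theorem, the polynomials vanishing eventually along a family of points
vanish simultaneously at eventually every point of the family. -/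
theorem eventually_forall_eval_eq_zero {σ ι K : Type*} [Finite σ] [Field K] (l : Filter ι)
    (b : ι → σ → K) :
    ∀ᶠ j in l, ∀ q : MvPolynomial σ K, (∀ᶠ j in l, eval (b j) q = 0) → eval (b j) q = 0 := by
  let I : Ideal (MvPolynomial σ K) :=
    { carrier := {q | ∀ᶠ j in l, eval (b j) q = 0}
      add_mem' := fun {p q} hp hq => by
        filter_upwards [hp, hq] with j h₁ h₂
        rw [map_add, h₁, h₂, add_zero]
      zero_mem' := .of_forall fun j => map_zero _
      smul_mem' := fun c q hq => by
        filter_upwards [hq] with j h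
        rw [smul_eq_mul, map_mul, h, mul_zero] }
  obtain ⟨s, hs⟩ := (isNoetherianRing_iff_ideal_fg _).1 inferInstance I
  have hev : ∀ᶠ j in l, ∀ q ∈ s, eval (b j) q = 0 :=
    (Filter.eventually_all_finset s).2 fun q hq => by
      have : q ∈ I := hs ▸ Ideal.subset_span hq
      exact this
  filter_upwards [hev] with j hj q hq
  have hle : I ≤ RingHom.ker (eval (b j)) := by
    rw [← hs, Ideal.span_le]
    exact hj
  exact hle hq

theorem eventually_eventually_eval_swap {σ ι κ K : Type*} [Finite σ] [Field K] {l : Filter ι}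
    {l' : Filter κ} {p : ι → MvPolynomial σ K} {b : κ → σ → K}
    (h : ∀ᶠ i in l, ∀ᶠ j in l', eval (b j) (p i) = 0) :
    ∀ᶠ j in l', ∀ᶠ i in l, eval (b j) (p i) = 0 := by
  filter_upwards [eventually_forall_eval_eq_zero l' b] with j hj
  exact h.mono fun i hi => hj _ hi

theorem eval_aeval_append_C_X {m n : ℕ} (p : MvPolynomial (Fin (m + n)) ℝ) (x : Fin m → ℝ)
    (y : Fin n → ℝ) :
    eval y (aeval (Fin.append (fun i => C (x i)) X) p : MvPolynomial (Fin n) ℝ) =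
      eval (Fin.append x y) p := by
  induction p using MvPolynomial.induction_on with
  | C r => simp
  | add p q hp hq => rw [map_add, map_add, hp, hq, map_add]
  | mul_X p i hp =>
    rw [map_mul, map_mul, hp, map_mul, aeval_X, eval_X]
    congr 1
    induction i using Fin.addCases <;> simp

theorem eval_aeval_append_X_C {m n : ℕ} (p : MvPolynomial (Fin (m + n)) ℝ) (x : Fin m → ℝ)
    (y : Fin n → ℝ) :
    eval x (aeval (Fin.append X (fun j => C (y j))) p : MvPolynomial (Fin m) ℝ) =
      eval (Fin.append x y) p := by
  induction p using MvPolynomial.induction_on with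
  | C r => simp
  | add p q hp hq => rw [map_add, map_add, hp, hq, map_add]
  | mul_X p i hp =>
    rw [map_mul, map_mul, hp, map_mul, aeval_X, eval_X]
    congr 1
    induction i using Fin.addCases <;> simp

theorem EquationallyDefinable.iteratedLimitsCommute {m n : ℕ} {s : Set (Fin (m + n) → ℝ)}
    (hs : EquationallyDefinable (m + n) s) :
    IteratedLimitsCommute {x : (Fin m → ℝ) × (Fin n → ℝ) | Fin.append x.1 x.2 ∈ s} := by
  induction hs with
  | zero p =>
    intro a b
    constructor <;> intro h
    · simp only [mem_ofPred_eq, ← eval_aeval_append_C_X] at h ⊢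
      exact eventually_eventually_eval_swap h
    · simp only [mem_ofPred_eq, ← eval_aeval_append_X_C] at h ⊢
      exact eventually_eventually_eval_swap h
  | compl _ ih => exact ih.compl
  | union _ _ ihs iht => exact ihs.union iht

theorem EquationallyDefinableProd.iteratedLimitsCommute {m n : ℕ}
    {Z : Set ((Fin m → ℝ) × (Fin n → ℝ))} (hZ : EquationallyDefinableProd m n Z) :
    IteratedLimitsCommute Z := by
  have : {x : (Fin m → ℝ) × (Fin n → ℝ) | Fin.append x.1 x.2 ∈ joinR m n ⁻¹' Z} = Z := by
    ext x; simp [joinR]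
  exact this ▸ EquationallyDefinable.iteratedLimitsCommute hZ

theorem SpecialStable.iteratedLimitsCommute {m n : ℕ} {D : Set ((Fin m → ℝ) × (Fin n → ℝ))}
    (hD : SpecialStable m n D) : IteratedLimitsCommute D := by
  obtain ⟨Z, X, Y, hZ, -, -, rfl⟩ := hD
  exact hZ.iteratedLimitsCommute.inter (.prod X Y)

theorem stmt12 (m n : ℕ) (hm : 1 ≤ m) (hn : 1 ≤ n) :
    (∀ (Z : Set ((Fin m → ℝ) × (Fin n → ℝ))) (X : Set (Fin m → ℝ)) (Y : Set (Fin n → ℝ)),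
      EquationallyDefinableProd m n Z → IsStable (Z ∩ X ×ˢ Y)) ∧
    (∀ D : Set ((Fin m → ℝ) × (Fin n → ℝ)), SpecialStable m n D → IsStable D) ∧
    (∀ (k : ℕ) (S : Fin k → Set ((Fin m → ℝ) × (Fin n → ℝ))),
      (∀ i, SpecialStable m n (S i)) → IsStable (⋃ i, S i)) := by
  exact ⟨fun Z X Y hZ => (hZ.iteratedLimitsCommute.inter (.prod X Y)).isStable,
    fun D hD => hD.iteratedLimitsCommute.isStable,
    fun k S hS => (IteratedLimitsCommute.iUnion fun i => (hS i).iteratedLimitsCommute).isStable⟩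
end

section
/- Let S and T be sets, let n ≥ 1, let D₁, …, Dₙ ⊆ S × T be stable sets, and let D ⊆ S × T with D ⊆ D₁ ∪ ⋯ ∪ Dₙ. Then D is stable if and only if D ∩ Dᵢ is stable for each i ∈ {1, …, n}. -/
open Set

/-- Infinite Ramsey theorem for pairs: if finitely many relations cover all pairs `i < j`, then one
of them holds on all increasing pairs of some infinite subsequence. -/
theorem exists_strictMono_forall_lt_of_finite {κ : Type*} [Finite κ] (R : κ → ℕ → ℕ → Prop)
    (hR : ∀ i j, i < j → ∃ k, R k i j) :
    ∃ (k : κ) (g : ℕ → ℕ), StrictMono g ∧ ∀ i j, i < j → R k (g i) (g j) := by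
  let U : Ultrafilter ℕ := Filter.hyperfilter ℕ
  have hgt (i : ℕ) : ∀ᶠ j in (U : Filter ℕ), i < j := by
    have h := Filter.eventually_gt_atTop i
    rw [← Nat.cofinite_eq_atTop] at h
    exact Filter.hyperfilter_le_cofinite h
  have hcol (i : ℕ) : ∃ k, ∀ᶠ j in (U : Filter ℕ), R k i j :=
    Ultrafilter.eventually_exists_iff.mp ((hgt i).mono (hR i))
  obtain ⟨k, hk⟩ : ∃ k, ∀ᶠ i in (U : Filter ℕ), ∀ᶠ j in (U : Filter ℕ), R k i j :=
    Ultrafilter.eventually_exists_iff.mp (Filter.Eventually.of_forall hcol)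
  obtain ⟨g, -, hg⟩ := exists_seq_of_forall_finset_exists
    (fun i => ∀ᶠ j in (U : Filter ℕ), R k i j) (fun i j => i < j ∧ R k i j) (by
      intro s hs
      have h : ∀ᶠ j in (U : Filter ℕ), ∀ i ∈ s, i < j ∧ R k i j :=
        (Filter.eventually_all_finset s).mpr fun i hi => (hgt i).and (hs i hi)
      exact (hk.and h).exists)
  exact ⟨k, g, fun i j hij => (hg i j hij).1, fun i j hij => (hg i j hij).2⟩

/-- A half-graph whose diagonal is unconstrained already contradicts stability. -/
theorem IsStable.not_forall_lt {S T : Type*} {D : Set (S × T)} (hD : IsStable D)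
    (a : ℕ → S) (b : ℕ → T) : ¬ ∀ i j, i < j → (a i, b j) ∈ D ∧ (a j, b i) ∉ D := by
  intro h
  refine hD ⟨fun i => a (2 * i), fun j => b (2 * j + 1), fun i j => ⟨fun hij => ?_, fun hij => ?_⟩⟩
  · by_contra hlt
    exact (h (2 * j + 1) (2 * i) (by omega)).2 hij
  · exact (h (2 * i) (2 * j + 1) (by omega)).1

theorem IsStable.inter {S T : Type*} {D E : Set (S × T)} (hD : IsStable D) (hE : IsStable E) :
    IsStable (D ∩ E) := by
  rintro ⟨a, b, h⟩
  obtain ⟨k, g, hg, hk⟩ := exists_strictMono_forall_lt_of_finite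
    (fun (k : Bool) i j => (a j, b i) ∉ if k then D else E) (by
      intro i j hij
      by_contra! hc
      exact hij.not_ge ((h j i).mp ⟨by simpa using hc true, by simpa using hc false⟩))
  have hmem (i j : ℕ) (hij : i < j) := (h (g i) (g j)).mpr (hg hij).le
  cases k with
  | true => exact hD.not_forall_lt (a ∘ g) (b ∘ g) fun i j hij =>
      ⟨(hmem i j hij).1, by simpa using hk i j hij⟩
  | false => exact hE.not_forall_lt (a ∘ g) (b ∘ g) fun i j hij =>
      ⟨(hmem i j hij).2, by simpa using hk i j hij⟩

theorem IsStable.of_subset_iUnion {S T κ : Type*} [Finite κ] {D : Set (S × T)}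
    {E : κ → Set (S × T)} (hsub : D ⊆ ⋃ k, E k) (h : ∀ k, IsStable (D ∩ E k)) : IsStable D := by
  rintro ⟨a, b, hab⟩
  obtain ⟨k, g, hg, hk⟩ := exists_strictMono_forall_lt_of_finite
    (fun k i j => (a i, b j) ∈ E k)
    (fun i j hij => mem_iUnion.mp (hsub ((hab i j).mpr hij.le)))
  exact (h k).not_forall_lt (a ∘ g) (b ∘ g) fun i j hij =>
    ⟨⟨(hab _ _).mpr (hg hij).le, hk i j hij⟩,
      fun hm => (hg hij).not_ge ((hab _ _).mp hm.1)⟩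

theorem stmt14 {S T : Type*} (n : ℕ) (hn : 1 ≤ n) (Ds : Fin n → Set (S × T))
    (hDs : ∀ i, IsStable (Ds i)) (D : Set (S × T)) (hsub : D ⊆ ⋃ i, Ds i) :
    IsStable D ↔ ∀ i, IsStable (D ∩ Ds i) :=
  ⟨fun hD i => hD.inter (hDs i), IsStable.of_subset_iUnion hsub⟩
end
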